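/- Fix $\alpha < 1$ (or the degenerate case with $\gamma_{n,k}=k$) and let $S_\alpha(n,k)$ be the associated generalized Stirling numbers with recursion $S_\alpha(n+1,k) = \gamma_{n,k} S_\alpha(n,k) + S_\alpha(n,k-1)$ where $\gamma_{n,k} = n - \alpha k$. Then for each fixed $n \ge 2$, the quantity $S_\alpha(n-1,k-1)/S_\alpha(n,k)$ is increasing in $k$ for $1 \le k \le n$. -/

import Mathlib

/-- Generalized Stirling numbers: `S_α(1,1) = 1`, `S_α(n,0) = 0` for `n ≥ 1`,
`S_α(n,k) = 0` for `k > n`, and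
`S_α(n+1,k) = γ_{n,k} S_α(n,k) + S_α(n,k-1)` with `γ_{n,k} = n - α k`. -/
def genStirling (α : ℝ) : ℕ → ℕ → ℝ
  | 0, k => if k = 0 then 1 else 0
  | n + 1, k =>
      if k = 0 then 0
      else ((n : ℝ) - α * k) * genStirling α n k + genStirling α n (k - 1)

lemma genStirling_zero_right (α : ℝ) {n : ℕ} (hn : 1 ≤ n) : genStirling α n 0 = 0 := by
  obtain ⟨m, rfl⟩ := Nat.exists_eq_add_of_le' hn
  simp [genStirling]

lemma genStirling_succ_succ (α : ℝ) (n k : ℕ) :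
    genStirling α (n + 1) (k + 1) =
      ((n : ℝ) - α * (k + 1)) * genStirling α n (k + 1) + genStirling α n k := by
  simp [genStirling]

lemma genStirling_eq_zero_of_lt (α : ℝ) {n k : ℕ} (h : n < k) : genStirling α n k = 0 := by
  induction n generalizing k with
  | zero => simp [genStirling, h.ne']
  | succ n ih =>
    obtain ⟨j, rfl⟩ := Nat.exists_eq_add_of_le' (Nat.one_le_of_lt h)
    rw [genStirling_succ_succ, ih (by omega), ih (by omega)]
    ring

lemma genStirling_self (α : ℝ) (n : ℕ) : genStirling α n n = 1 := by
  induction n with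
  | zero => simp [genStirling]
  | succ n ih =>
    rw [genStirling_succ_succ, ih, genStirling_eq_zero_of_lt α (Nat.lt_succ_self n)]
    ring

lemma one_sub_le_sub_mul {α : ℝ} (hα : α < 1) {n k : ℕ} (hk : 1 ≤ k) (hkn : k ≤ n) :
    1 - α ≤ (n : ℝ) - α * k := by
  have h1 : (1 : ℝ) ≤ k := by exact_mod_cast hk
  have h2 : (k : ℝ) ≤ n := by exact_mod_cast hkn
  nlinarith

lemma genStirling_pos {α : ℝ} (hα : α < 1) {n k : ℕ} (hk : 1 ≤ k) (hkn : k ≤ n) :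
    0 < genStirling α n k := by
  induction n generalizing k with
  | zero => omega
  | succ n ih =>
    rcases hkn.eq_or_lt with rfl | hlt
    · simp [genStirling_self]
    · obtain ⟨j, rfl⟩ := Nat.exists_eq_add_of_le' hk
      have hγ := one_sub_le_sub_mul hα hk (Nat.le_of_lt_succ hlt)
      push_cast at hγ
      have hpos := mul_pos (by linarith : 0 < (n : ℝ) - α * (j + 1))
        (ih hk (Nat.le_of_lt_succ hlt))
      rw [genStirling_succ_succ]
      rcases Nat.eq_zero_or_pos j with rfl | hj
      · rw [genStirling_zero_right α (by omega : 1 ≤ n)]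
        linarith
      · linarith [ih hj (by omega)]

/-- The ratio `S_α(n+1,k+1) / S_α(n,k)`, with junk value `0` at `k = 0 < n`. -/
noncomputable def genStirlingRatio (α : ℝ) (n k : ℕ) : ℝ :=
  genStirling α (n + 1) (k + 1) / genStirling α n k

lemma genStirlingRatio_zero_right (α : ℝ) {n : ℕ} (hn : 1 ≤ n) : genStirlingRatio α n 0 = 0 := by
  simp [genStirlingRatio, genStirling_zero_right α hn]

lemma genStirlingRatio_self (α : ℝ) (n : ℕ) : genStirlingRatio α n n = 1 := by
  simp [genStirlingRatio, genStirling_self]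

lemma one_le_genStirlingRatio {α : ℝ} (hα : α < 1) {n k : ℕ} (hk : 1 ≤ k) (hkn : k ≤ n) :
    1 ≤ genStirlingRatio α n k := by
  rcases hkn.eq_or_lt with rfl | hlt
  · rw [genStirlingRatio_self]
  · have hγ := one_sub_le_sub_mul hα (by omega : 1 ≤ k + 1) hlt
    push_cast at hγ
    have hpos := mul_pos (by linarith : 0 < (n : ℝ) - α * (k + 1))
      (genStirling_pos hα (by omega : 1 ≤ k + 1) hlt)
    rw [genStirlingRatio, one_le_div (genStirling_pos hα hk hkn), genStirling_succ_succ]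
    linarith

lemma genStirlingRatio_succ_left {α : ℝ} (hα : α < 1) {n k : ℕ} (hkn : k + 1 ≤ n) :
    genStirlingRatio α (n + 1) (k + 1) =
      1 + ((n : ℝ) + 1 - α * (k + 2)) / (n - α * (k + 1)) *
        (genStirlingRatio α n (k + 1) * (1 - (genStirlingRatio α n k)⁻¹)) := by
  have hγ := one_sub_le_sub_mul hα (by omega : 1 ≤ k + 1) hkn
  push_cast at hγ
  have hγ0 : (n : ℝ) - α * (k + 1) ≠ 0 := by linarith
  have h1 := (genStirling_pos hα (by omega : 1 ≤ k + 1) hkn).ne'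
  have h2 := (genStirling_pos hα (by omega : 1 ≤ k + 1) (by omega : k + 1 ≤ n + 1)).ne'
  have hinv : 1 - (genStirlingRatio α n k)⁻¹ =
      ((n : ℝ) - α * (k + 1)) * genStirling α n (k + 1) / genStirling α (n + 1) (k + 1) := by
    rw [genStirlingRatio, inv_div, eq_div_iff h2, sub_mul, div_mul_cancel₀ _ h2,
      genStirling_succ_succ]
    ring
  rw [hinv, genStirlingRatio, genStirlingRatio, genStirling_succ_succ α (n + 1) (k + 1)]
  push_cast
  field_simp
  ring

/-- One step of the induction in `n`, with `G = n - α (k + 1)`, `y = S_α(n+1,k+1) / S_α(n,k) - 1`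
and `c` the defect in the ratio bound. -/
lemma ratio_bound_const {α c G : ℝ} (hα : α < 1) (hc0 : 0 ≤ c)
    (hc : c ≤ (1 - α) * α ∨ c = 0) (hG : 1 - α ≤ G + α) :
    1 ≤ (1 - c / (G + 1)) * (1 + (G + 1) / (G + α) * (c / (G + α))) := by
  have h1 : 0 < G + α := by linarith
  have h2 : 0 < G + 1 := by linarith
  have key : (1 - c / (G + 1)) * (1 + (G + 1) / (G + α) * (c / (G + α))) - 1 =
      c * ((G + 1) * (G + 1 - c) - (G + α) ^ 2) / ((G + 1) * (G + α) ^ 2) := by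
    field_simp
    ring
  have : 0 ≤ c * ((G + 1) * (G + 1 - c) - (G + α) ^ 2) / ((G + 1) * (G + α) ^ 2) := by
    refine div_nonneg ?_ (by positivity)
    rcases hc with hc | rfl
    · refine mul_nonneg hc0 ?_
      have h3 : (G + 1) * c ≤ (G + 1) * ((1 - α) * α) := mul_le_mul_of_nonneg_left hc h2.le
      have h4 : 0 ≤ (G + α) * ((1 - α) * (2 - α)) := by
        have : 0 < 1 - α := by linarith
        have : 0 < 2 - α := by linarith
        positivity
      nlinarith [pow_pos (by linarith : 0 < 1 - α) 3]
    · simp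
  linarith

lemma ratio_bound_slope {α c G : ℝ} (hc : α * (1 - α) ≤ c) (hαc : 0 ≤ α * (1 - α) * c)
    (hG : 0 < G) (hγ : 0 < G + α) :
    (G + 1 - α) / G * (1 - c / G) ≤ (1 - c / (G + 1)) * ((G + 1) / (G + α)) := by
  have e1 : (G + 1 - α) / G * (1 - c / G) = (G + 1 - α) * (G - c) / G ^ 2 := by
    field_simp
  have e2 : (1 - c / (G + 1)) * ((G + 1) / (G + α)) = (G + 1 - c) / (G + α) := by
    field_simp
  rw [e1, e2, div_le_div_iff₀ (by positivity) hγ]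
  nlinarith [mul_le_mul_of_nonneg_right hc hG.le]

lemma genStirlingRatio_succ_right_le {α : ℝ} (hα : α < 1) {n k : ℕ} (hk : 1 ≤ k) (hkn : k + 1 ≤ n) :
    genStirlingRatio α n (k + 1) ≤
      (1 - max α 0 * (1 - α) / (n - α * (k + 1))) * genStirlingRatio α n k := by
  set c := max α 0 * (1 - α) with hc_def
  have hε : 0 < 1 - α := by linarith
  have hc0 : 0 ≤ c := mul_nonneg (le_max_right _ _) hε.le
  have hcε : c ≤ 1 - α := by
    have : max α 0 ≤ 1 := max_le hα.le zero_le_one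
    nlinarith
  have hcα : α * (1 - α) ≤ c := mul_le_mul_of_nonneg_right (le_max_left _ _) hε.le
  have hcases : c ≤ (1 - α) * α ∨ c = 0 := by
    rcases le_total 0 α with h | h
    · left; rw [hc_def, max_eq_left h, mul_comm]
    · right; rw [hc_def, max_eq_right h, zero_mul]
  have hαc : 0 ≤ α * (1 - α) * c := by
    rcases hcases with h | h
    · exact mul_nonneg (by linarith) hc0
    · simp [h]
  clear_value c
  induction n generalizing k with
  | zero => omega
  | succ n ih =>
    have hkn' : k ≤ n := by omega
    obtain ⟨j, rfl⟩ := Nat.exists_eq_add_of_le' hk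
    set R := genStirlingRatio α n (j + 1) with hR
    have hR1 : 1 ≤ R := one_le_genStirlingRatio hα hk hkn'
    obtain ⟨G, hG⟩ : ∃ G : ℝ, G = (n : ℝ) - α * (j + 2) := ⟨_, rfl⟩
    have hγ := one_sub_le_sub_mul hα hk hkn'
    push_cast at hγ
    have hγG : (n : ℝ) - α * (j + 1) = G + α := by rw [hG]; ring
    rw [hγG] at hγ
    have hγ0 : 0 < G + α := by linarith
    have hG1 : 0 < G + 1 := by linarith
    have hτ : R * (genStirlingRatio α n j)⁻¹ ≤ 1 - c / (G + α) := by
      rcases Nat.eq_zero_or_pos j with rfl | hj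
      · rw [genStirlingRatio_zero_right α (by omega), inv_zero, mul_zero, sub_nonneg,
          div_le_one hγ0]
        linarith
      · rw [← div_eq_mul_inv,
          div_le_iff₀ (by linarith [one_le_genStirlingRatio hα hj (by omega : j ≤ n)]), ← hγG]
        exact ih hj hkn'
    have hlower : 1 + (G + 1) / (G + α) * (R - 1 + c / (G + α)) ≤
        genStirlingRatio α (n + 1) (j + 1) := by
      rw [genStirlingRatio_succ_left hα hkn', hγG,
        show (n : ℝ) + 1 - α * (j + 2) = G + 1 by rw [hG]; ring, ← hR]
      gcongr
      linarith
    have hfac : 0 ≤ 1 - c / (G + 1) := by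
      rw [sub_nonneg, div_le_one hG1]
      linarith
    have hconst := ratio_bound_const hα hc0 hcases hγ
    have hupper : genStirlingRatio α (n + 1) (j + 1 + 1) ≤
        1 + (1 - c / (G + 1)) * ((G + 1) / (G + α)) * (R - 1) := by
      rcases hkn'.eq_or_lt with h | h
      · rw [hR, h, genStirlingRatio_self, genStirlingRatio_self]
        simp
      · have hG0 := one_sub_le_sub_mul hα (by omega : 1 ≤ j + 1 + 1) h
        push_cast at hG0
        rw [show (n : ℝ) - α * (j + 1 + 1) = G by rw [hG]; ring] at hG0
        have hGpos : 0 < G := by linarith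
        have hstep := ih hk h
        push_cast at hstep
        rw [show (n : ℝ) - α * (j + 1 + 1) = G by rw [hG]; ring, ← hR] at hstep
        have hslope := ratio_bound_slope hcα hαc hGpos hγ0
        rw [genStirlingRatio_succ_left hα h]
        push_cast
        rw [show (n : ℝ) - α * (j + 1 + 1) = G by rw [hG]; ring,
          show (n : ℝ) + 1 - α * (j + 1 + 2) = G + 1 - α by rw [hG]; ring, ← hR]
        have hinv : 0 ≤ 1 - R⁻¹ := sub_nonneg.2 (inv_le_one_of_one_le₀ hR1)
        have hy : R * (1 - R⁻¹) = R - 1 := by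
          rw [mul_sub, mul_inv_cancel₀ (by linarith)]; ring
        have hφ : 0 ≤ (G + 1 - α) / G := div_nonneg (by linarith) hGpos.le
        calc 1 + (G + 1 - α) / G * (genStirlingRatio α n (j + 1 + 1) * (1 - R⁻¹))
            ≤ 1 + (G + 1 - α) / G * ((1 - c / G) * R * (1 - R⁻¹)) := by gcongr
          _ = 1 + (G + 1 - α) / G * (1 - c / G) * (R - 1) := by rw [← hy]; ring
          _ ≤ _ := by
            have : 0 ≤ R - 1 := by linarith
            gcongr
    push_cast
    rw [show (n : ℝ) + 1 - α * (j + 1 + 1) = G + 1 by rw [hG]; ring]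
    refine le_trans ?_ (mul_le_mul_of_nonneg_left hlower hfac)
    linarith

/-- For `α < 1` and fixed `n ≥ 2`, the ratio `S_α(n-1,k-1)/S_α(n,k)` is
increasing in `k` on `1 ≤ k ≤ n`. -/
theorem genStirling_ratio_increasing (α : ℝ) (hα : α < 1) (n : ℕ) (hn : 2 ≤ n)
    (k : ℕ) (hk1 : 1 ≤ k) (hkn : k + 1 ≤ n) :
    genStirling α (n - 1) (k - 1) / genStirling α n k ≤
      genStirling α (n - 1) k / genStirling α n (k + 1) := by
  obtain ⟨m, rfl⟩ := Nat.exists_eq_add_of_le' (by omega : 1 ≤ n)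
  obtain ⟨j, rfl⟩ := Nat.exists_eq_add_of_le' hk1
  simp only [Nat.add_sub_cancel]
  rw [← inv_div (genStirling α (m + 1) (j + 1)), ← inv_div (genStirling α (m + 1) (j + 1 + 1))]
  change (genStirlingRatio α m j)⁻¹ ≤ (genStirlingRatio α m (j + 1))⁻¹
  have hpos : 1 ≤ genStirlingRatio α m (j + 1) := one_le_genStirlingRatio hα hk1 (by omega)
  rcases Nat.eq_zero_or_pos j with rfl | hj
  · rw [genStirlingRatio_zero_right α (by omega), inv_zero]
    positivity
  · have hj1 : 1 ≤ genStirlingRatio α m j := one_le_genStirlingRatio hα hj (by omega)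
    refine inv_anti₀ (by linarith) ((genStirlingRatio_succ_right_le hα hj (by omega)).trans ?_)
    have hγ := one_sub_le_sub_mul hα hk1 (by omega : j + 1 ≤ m)
    push_cast at hγ
    have : 0 ≤ max α 0 * (1 - α) / (m - α * (j + 1)) :=
      div_nonneg (mul_nonneg (le_max_right _ _) (by linarith)) (by linarith)
    exact mul_le_of_le_one_left (by linarith) (by linarith)
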